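/- arXiv:2510.23791 — 2 statements merged into one kernel-verified Lean document; each statement's English description precedes it below -/
import Mathlib

section
/- Let n ≥ 2 be an integer, let 2 ≤ p₁ < p₂ be real numbers, and let ε ∈ (0,1). Then 𝒴(ε,p₂) is a proper subset of 𝒴(ε,p₁): every x ∈ Δₙ with (1 + ε·D_{p₂})·‖x‖_{p₂} ≤ 1 also satisfies (1 + ε·D_{p₁})·‖x‖_{p₁} ≤ 1, and there exists x ∈ 𝒴(ε,p₁) with x ∉ 𝒴(ε,p₂). -/
open Finset

/-- A probability vector satisfies `(∑ xᵢ ^ p) ^ r ≤ ∑ xᵢ ^ q` with `r = (q - 1) / (p - 1)`. -/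
theorem sum_rpow_rpow_le_sum_rpow {ι : Type*} [Fintype ι] {p q : ℝ} (hp : 1 < p) (hpq : p ≤ q)
    {x : ι → ℝ} (hx : ∀ i, 0 ≤ x i) (hs : ∑ i, x i = 1) :
    (∑ i, x i ^ p) ^ ((q - 1) / (p - 1)) ≤ ∑ i, x i ^ q := by
  have hr : 1 ≤ (q - 1) / (p - 1) := by
    rw [le_div_iff₀ (by linarith)]
    linarith
  have split (s : ℝ) (hs : 1 < s) (i : ι) : x i * x i ^ (s - 1) = x i ^ s := by
    rw [mul_comm, ← Real.rpow_add_one' (hx i) (by linarith), sub_add_cancel]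
  have h := Real.rpow_arith_mean_le_arith_mean_rpow univ x (fun i => x i ^ (p - 1))
    (fun i _ => hx i) hs (fun i _ => Real.rpow_nonneg (hx i) _) hr
  have hpow (i : ι) : (x i ^ (p - 1)) ^ ((q - 1) / (p - 1)) = x i ^ (q - 1) := by
    rw [← Real.rpow_mul (hx i), mul_div_cancel₀ _ (by linarith)]
  simpa only [hpow, split p hp, split q (by linarith)] using h

theorem sum_rpow_pos {ι : Type*} [Fintype ι] (p : ℝ) {x : ι → ℝ} (hx : ∀ i, 0 ≤ x i)
    (hs : ∑ i, x i = 1) : 0 < ∑ i, x i ^ p := by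
  obtain ⟨i, -, hi⟩ := exists_ne_zero_of_sum_ne_zero (hs.trans_ne one_ne_zero)
  exact sum_pos' (fun j _ => Real.rpow_nonneg (hx j) _)
    ⟨i, mem_univ i, Real.rpow_pos_of_pos ((hx i).lt_of_ne' hi) _⟩

theorem one_add_mul_rpow_lt {m a b ε : ℝ} (hm : 1 < m) (ha : 0 < a) (hab : a < b)
    (hε : ε ∈ Set.Ioo (0 : ℝ) 1) :
    (1 + ε * (m ^ a - 1)) ^ (b / a) < 1 + ε * (m ^ b - 1) := by
  have hq : 1 < b / a := (one_lt_div ha).2 hab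
  have hma : 1 < m ^ a := Real.one_lt_rpow hm ha
  have h := (strictConvexOn_rpow hq).2 (Set.mem_Ici.2 zero_le_one)
    (Set.mem_Ici.2 (zero_le_one.trans hma.le)) hma.ne (sub_pos.2 hε.2) hε.1 (by ring)
  simp only [smul_eq_mul, Real.one_rpow, ← Real.rpow_mul (zero_le_one.trans hm.le),
    mul_div_cancel₀ b ha.ne'] at h
  have affine (z : ℝ) : 1 + ε * (z - 1) = (1 - ε) * 1 + ε * z := by ring
  rwa [affine, affine]

theorem one_add_mul_norm_lt_one {ι : Type*} [Fintype ι] {m p q ε : ℝ} (hm : 1 < m) (hp : 1 < p)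
    (hpq : p < q) (hε : ε ∈ Set.Ioo (0 : ℝ) 1) {x : ι → ℝ} (hx : ∀ i, 0 ≤ x i)
    (hs : ∑ i, x i = 1)
    (h : (1 + ε * (m ^ (1 - 1 / q) - 1)) * (∑ i, x i ^ q) ^ (1 / q) ≤ 1) :
    (1 + ε * (m ^ (1 - 1 / p) - 1)) * (∑ i, x i ^ p) ^ (1 / p) < 1 := by
  have hp0 : 0 < p := by linarith
  have hq0 : 0 < q := by linarith
  have ha : 0 < 1 - 1 / p := sub_pos.2 ((div_lt_one hp0).2 hp)
  have hab : 1 - 1 / p < 1 - 1 / q := sub_lt_sub_left (one_div_lt_one_div_of_lt hp0 hpq) 1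
  have hS := sum_rpow_pos p hx hs
  have hA : 0 < 1 + ε * (m ^ (1 - 1 / p) - 1) := by
    nlinarith [mul_pos hε.1 (sub_pos.2 (Real.one_lt_rpow hm ha))]
  have hB := one_add_mul_rpow_lt hm ha hab hε
  set r := (1 - 1 / q) / (1 - 1 / p) with hr
  have hr0 : 0 < r := div_pos (ha.trans hab) ha
  have hexp : 1 / p * r = (q - 1) / (p - 1) * (1 / q) := by
    have : p - 1 ≠ 0 := by linarith
    rw [hr]
    field_simp
  have hN : ((∑ i, x i ^ p) ^ (1 / p)) ^ r ≤ (∑ i, x i ^ q) ^ (1 / q) := by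
    rw [← Real.rpow_mul hS.le, hexp, Real.rpow_mul hS.le]
    exact Real.rpow_le_rpow (Real.rpow_nonneg hS.le _)
      (sum_rpow_rpow_le_sum_rpow hp hpq.le hx hs) (by positivity)
  have hN0 : 0 < (∑ i, x i ^ p) ^ (1 / p) := Real.rpow_pos_of_pos hS _
  rw [← Real.rpow_lt_rpow_iff (mul_pos hA hN0).le zero_le_one hr0, Real.one_rpow,
    Real.mul_rpow hA.le hN0.le]
  refine lt_of_lt_of_le ?_ h
  exact mul_lt_mul hB hN (Real.rpow_pos_of_pos hN0 _) ((Real.rpow_pos_of_pos hA _).trans hB).le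

theorem exists_one_add_mul_norm_eq_one {n : ℕ} (hn : 2 ≤ n) {p ε : ℝ} (hp : 1 < p)
    (hε : ε ∈ Set.Ioo (0 : ℝ) 1) :
    ∃ x : Fin n → ℝ, (∀ i, 0 ≤ x i) ∧ ∑ i, x i = 1 ∧
      (1 + ε * ((n : ℝ) ^ (1 - 1 / p) - 1)) * (∑ i, x i ^ p) ^ (1 / p) = 1 := by
  have hp0 : 0 < p := by linarith
  have hm : (1 : ℝ) < n := by exact_mod_cast hn
  have hm0 : (0 : ℝ) < n := by linarith
  have hD : 1 < (n : ℝ) ^ (1 - 1 / p) :=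
    Real.one_lt_rpow hm (sub_pos.2 ((div_lt_one hp0).2 hp))
  let j : Fin n := ⟨0, by omega⟩
  let y : ℝ → Fin n → ℝ := fun t i => (1 - t) * (n : ℝ)⁻¹ + t * (Pi.single j 1 : Fin n → ℝ) i
  let f : ℝ → ℝ := fun t =>
    (1 + ε * ((n : ℝ) ^ (1 - 1 / p) - 1)) * (∑ i, y t i ^ p) ^ (1 / p)
  have hf : Continuous f := by
    refine continuous_const.mul (Continuous.rpow_const ?_ fun _ => Or.inr (by positivity))
    exact continuous_finsetSum _ fun i _ =>
      Continuous.rpow_const (by fun_prop) fun _ => Or.inr hp0.le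
  have hf0 : f 0 ≤ 1 := by
    have hsum : ∑ i, y 0 i ^ p = (n : ℝ) * (n : ℝ)⁻¹ ^ p := by simp [y]
    have hN : (∑ i, y 0 i ^ p) ^ (1 / p) = ((n : ℝ) ^ (1 - 1 / p))⁻¹ := by
      rw [hsum, Real.mul_rpow hm0.le (by positivity), ← Real.rpow_mul (by positivity),
        mul_one_div_cancel hp0.ne', Real.rpow_one, Real.rpow_sub hm0, Real.rpow_one, inv_div]
      rfl
    simp only [f, hN]
    rw [← div_eq_mul_inv, div_le_one (by linarith)]
    nlinarith [hε.2]
  have hf1 : 1 ≤ f 1 := by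
    have hsum : ∑ i, y 1 i ^ p = 1 := by
      simp [y, Pi.single_apply, apply_ite (fun z : ℝ => z ^ p), Real.zero_rpow hp0.ne']
    simp only [f, hsum, Real.one_rpow, mul_one]
    nlinarith [hε.1]
  obtain ⟨t, ⟨ht0, ht1⟩, ht⟩ := intermediate_value_Icc zero_le_one hf.continuousOn ⟨hf0, hf1⟩
  refine ⟨y t, fun i => ?_, ?_, ht⟩
  · have hsingle : 0 ≤ (Pi.single j 1 : Fin n → ℝ) i := by
      rw [Pi.single_apply]
      split_ifs <;> norm_num
    have := sub_nonneg.2 ht1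
    positivity
  · simp only [y, sum_add_distrib, ← mul_sum, sum_const, card_univ, Fintype.card_fin, nsmul_eq_mul,
      sum_pi_single', mem_univ, if_true]
    field_simp
    ring

/-- for `2 ≤ p₁ < p₂` and `ε ∈ (0,1)`, `𝒴(ε,p₂)` is a proper subset
of `𝒴(ε,p₁)`. -/
theorem stmt_9 (n : ℕ) (hn : 2 ≤ n) (p₁ p₂ : ℝ) (hp₁ : 2 ≤ p₁) (hp₁₂ : p₁ < p₂)
    (ε : ℝ) (hε : ε ∈ Set.Ioo (0:ℝ) 1) :
    (∀ x : Fin n → ℝ, (∀ i, 0 ≤ x i) → ∑ i, x i = 1 →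
      (1 + ε * ((n : ℝ) ^ (1 - 1/p₂) - 1)) * (∑ i, x i ^ p₂) ^ (1/p₂) ≤ 1 →
      (1 + ε * ((n : ℝ) ^ (1 - 1/p₁) - 1)) * (∑ i, x i ^ p₁) ^ (1/p₁) ≤ 1)
    ∧
    (∃ x : Fin n → ℝ, (∀ i, 0 ≤ x i) ∧ ∑ i, x i = 1 ∧
      (1 + ε * ((n : ℝ) ^ (1 - 1/p₁) - 1)) * (∑ i, x i ^ p₁) ^ (1/p₁) ≤ 1 ∧
      ¬ (1 + ε * ((n : ℝ) ^ (1 - 1/p₂) - 1)) * (∑ i, x i ^ p₂) ^ (1/p₂) ≤ 1) := by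
  refine ⟨fun x hx hs h => ?_, ?_⟩
  · exact (one_add_mul_norm_lt_one (by exact_mod_cast hn) (by linarith) hp₁₂ hε hx hs h).le
  · obtain ⟨x, hx, hs, h⟩ := exists_one_add_mul_norm_eq_one hn (by linarith : 1 < p₁) hε
    exact ⟨x, hx, hs, h.le, fun h₂ =>
      (one_add_mul_norm_lt_one (by exact_mod_cast hn) (by linarith) hp₁₂ hε hx hs h₂).ne h⟩
end

section
/- Let n ≥ 2 be an integer, p ≥ 2 a real number, and let x ∈ Δₙ be neither a standard unit vector nor the uniform vector (1/n)·e. Then (p/(p−1))·(−ln ‖x‖_p)/(1 − ‖x‖_p) − (ln n)·(1 + 1/D_p) < 0. -/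
open Finset

theorem neg_log_div_one_sub_lt {m t : ℝ} (hm : 0 < m) (hmt : m < t) (ht : t < 1) :
    -Real.log t / (1 - t) < -Real.log m / (1 - m) := by
  have h := strictConcaveOn_log_Ioi.slope_anti_adjacent (Set.mem_Ioi.2 hm)
    (Set.mem_Ioi.2 one_pos) hmt ht
  rw [Real.log_one, div_lt_div_iff₀ (by linarith) (by linarith)] at h
  rw [div_lt_div_iff₀ (by linarith) (by linarith)]
  linarith

theorem sum_rpow_lt_one {ι : Type*} [Fintype ι] [DecidableEq ι] {p : ℝ} (hp : 1 < p)
    {x : ι → ℝ} (hx : ∀ i, 0 ≤ x i) (hsum : ∑ i, x i = 1)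
    (hunit : ∀ i, x ≠ fun j => if j = i then (1 : ℝ) else 0) :
    ∑ i, x i ^ p < 1 := by
  have hlt : ∀ i, x i < 1 := by
    intro i
    have hi : x i + ∑ j ∈ univ.erase i, x j = 1 := by
      rw [add_sum_erase _ _ (mem_univ i), hsum]
    have hnn : 0 ≤ ∑ j ∈ univ.erase i, x j := sum_nonneg fun j _ => hx j
    refine lt_of_le_of_ne (by linarith) fun h => hunit i ?_
    have hz := (sum_eq_zero_iff_of_nonneg fun j _ => hx j).1
      (show ∑ j ∈ univ.erase i, x j = 0 by linarith)
    funext j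
    split_ifs with hj
    · rw [hj, h]
    · exact hz j (mem_erase.2 ⟨hj, mem_univ j⟩)
  obtain ⟨i, -, hi⟩ : ∃ i ∈ univ, 0 < x i := by
    by_contra! h
    linarith [sum_nonpos h]
  rw [← hsum]
  refine sum_lt_sum (fun j _ => ?_) ⟨i, mem_univ i, ?_⟩
  · simpa using Real.rpow_le_rpow_of_exponent_ge_of_imp (hx j) (hlt j).le hp.le
      (fun _ h => absurd h (by linarith))
  · simpa using Real.rpow_lt_rpow_of_exponent_gt hi (hlt i) hp

theorem rpow_one_sub_lt_sum_rpow {n : ℕ} (hn : 0 < n) {p : ℝ} (hp : 1 < p)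
    {x : Fin n → ℝ} (hx : ∀ i, 0 ≤ x i) (hsum : ∑ i, x i = 1)
    (hunif : x ≠ fun _ : Fin n => 1 / (n : ℝ)) :
    (n : ℝ) ^ (1 - p) < ∑ i, x i ^ p := by
  have hn0 : (0 : ℝ) < n := by exact_mod_cast hn
  obtain ⟨j, k, hjk⟩ : ∃ j k, x j ≠ x k := by
    by_contra! h
    refine hunif (funext fun i => ?_)
    rw [sum_congr rfl fun j _ => h j i] at hsum
    simp only [sum_const, card_univ, Fintype.card_fin, nsmul_eq_mul] at hsum
    rw [eq_div_iff hn0.ne']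
    linarith
  have h := (strictConvexOn_rpow hp).map_sum_lt (t := univ) (w := fun _ : Fin n => (n : ℝ)⁻¹)
    (p := x) (fun _ _ => by positivity) (by simp [hn0.ne']) (fun i _ => hx i)
    ⟨j, mem_univ j, k, mem_univ k, hjk⟩
  simp only [smul_eq_mul, ← mul_sum, hsum, mul_one] at h
  rw [Real.inv_rpow hn0.le, inv_mul_eq_div, lt_div_iff₀ hn0] at h
  rwa [Real.rpow_sub hn0, Real.rpow_one, div_eq_inv_mul]

/-- for `x ∈ Δₙ` neither a standard unit vector nor the uniform vector,
`(p/(p-1))·(-ln ‖x‖_p)/(1 - ‖x‖_p) - (ln n)·(1 + 1/D_p) < 0`. -/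
theorem stmt_11 (n : ℕ) (hn : 2 ≤ n) (p : ℝ) (hp : 2 ≤ p)
    (x : Fin n → ℝ) (hx : ∀ i, 0 ≤ x i) (hsum : ∑ i, x i = 1)
    (hunit : ∀ i : Fin n, x ≠ fun j => if j = i then (1:ℝ) else 0)
    (hunif : x ≠ fun _ : Fin n => 1 / (n : ℝ)) :
    (p / (p - 1)) * ((- Real.log ((∑ i, x i ^ p) ^ (1/p))) / (1 - (∑ i, x i ^ p) ^ (1/p)))
      - Real.log n * (1 + 1 / ((n : ℝ) ^ (1 - 1/p) - 1)) < 0 := by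
  have hn1 : (1 : ℝ) < n := by exact_mod_cast hn
  have hn0 : (0 : ℝ) < n := by linarith
  have hp0 : 0 < p := by linarith
  have hp1 : 0 < p - 1 := by linarith
  have hS1 := sum_rpow_lt_one (by linarith : 1 < p) hx hsum hunit
  have hSm := rpow_one_sub_lt_sum_rpow (by lia : 0 < n) (by linarith : 1 < p) hx hsum hunif
  have hS0 : 0 < ∑ i, x i ^ p := (Real.rpow_pos_of_pos hn0 _).trans hSm
  have ht1 : (∑ i, x i ^ p) ^ (1 / p) < 1 := Real.rpow_lt_one hS0.le hS1 (by positivity)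
  have hq : 1 - 1 / p = (p - 1) / p := by field_simp
  have hA : 1 < (n : ℝ) ^ (1 - 1 / p) :=
    Real.one_lt_rpow hn1 (by rw [hq]; positivity)
  have hmt : ((n : ℝ) ^ (1 - 1 / p))⁻¹ < (∑ i, x i ^ p) ^ (1 / p) := by
    have h := Real.rpow_lt_rpow (by positivity) hSm (by positivity : 0 < 1 / p)
    rw [← Real.rpow_mul hn0.le] at h
    rw [← Real.rpow_neg hn0.le]
    convert h using 2
    field_simp
    ring
  have key := mul_lt_mul_of_pos_left (neg_log_div_one_sub_lt (by positivity) hmt ht1)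
    (div_pos hp0 hp1)
  have hrhs : p / (p - 1) * (-Real.log ((n : ℝ) ^ (1 - 1 / p))⁻¹ /
      (1 - ((n : ℝ) ^ (1 - 1 / p))⁻¹)) =
      Real.log n * (1 + 1 / ((n : ℝ) ^ (1 - 1 / p) - 1)) := by
    rw [Real.log_inv, Real.log_rpow hn0, neg_neg]
    generalize (n : ℝ) ^ (1 - 1 / p) = A at hA
    have hA1 : A - 1 ≠ 0 := by linarith
    have hA0 : A ≠ 0 := by linarith
    have hinv : 1 - A⁻¹ = (A - 1) / A := by field_simp
    rw [hq, hinv]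
    field_simp
    ring
  linarith
end
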